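/- Let p ∈ ℂ[x] with n = deg p ≥ 1, and let σ be an anti-involution of 𝒟ᵃ_p preserving the principal ℤ-gradation. Then there exists a unique c ∈ ℂ with p(x) = (−1)^n·p(−x + c), and σ equals either σ_+ or σ_−, where σ_±(t^k f(D)p(D)) = (−1)^n·(±1)^k·t^k f(−D − k + c)p(D). In particular there are exactly two anti-involutions of 𝒟ᵃ_p preserving the principal gradation. -/

import Mathlib

noncomputable section

/-- ℂ[t,t⁻¹] as a ℂ-vector space with basis {t^j}_{j∈ℤ}; t^j is `Finsupp.single j 1`. -/
abbrev LaurentV : Type := ℤ →₀ ℂ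

/-- The regular differential operator `t^k f(D)` (where D = t·d/dt), acting by
t^j ↦ f(j)·t^{j+k}. -/
def op (k : ℤ) (f : Polynomial ℂ) : Module.End ℂ LaurentV :=
  Finsupp.lsum ℂ fun j => f.eval (j : ℂ) • Finsupp.lsingle (j + k)

/-- The graded piece (𝒟ᵃ_p)_j = {t^j f(D) p(D) : f ∈ ℂ[x]}. -/
def Dgrade (p : Polynomial ℂ) (j : ℤ) : Submodule ℂ (Module.End ℂ LaurentV) :=
  Submodule.span ℂ {A | ∃ f : Polynomial ℂ, A = op j (f * p)}

/-- 𝒟ᵃ_p = 𝒟ᵃ·p(D). -/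
def Dp (p : Polynomial ℂ) : Submodule ℂ (Module.End ℂ LaurentV) :=
  Submodule.span ℂ {A | ∃ (k : ℤ) (f : Polynomial ℂ), A = op k (f * p)}

/-- σ is an anti-involution: it is ℂ-linear (built into the type), involutive, and
reverses products. -/
def IsAntiInvolutionOn (p : Polynomial ℂ) (σ : ↥(Dp p) →ₗ[ℂ] ↥(Dp p)) : Prop :=
  (∀ A : ↥(Dp p), σ (σ A) = A) ∧
  (∀ A B W : ↥(Dp p),
    (W : Module.End ℂ LaurentV) = (A : Module.End ℂ LaurentV) * (B : Module.End ℂ LaurentV) →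
    ((σ W : Module.End ℂ LaurentV)) = (σ B : Module.End ℂ LaurentV) * (σ A : Module.End ℂ LaurentV))

/-- σ preserves the principal ℤ-gradation. -/
def PreservesGrading (p : Polynomial ℂ) (σ : ↥(Dp p) →ₗ[ℂ] ↥(Dp p)) : Prop :=
  ∀ (j : ℤ) (A : ↥(Dp p)), (A : Module.End ℂ LaurentV) ∈ Dgrade p j →
    ((σ A : Module.End ℂ LaurentV)) ∈ Dgrade p j

/-- σ(t^k f(D) p(D)) = (-1)^{deg p}·e^k·t^k f(−D−k+c)p(D). -/
def SigmaFormula (p : Polynomial ℂ) (c e : ℂ) (σ : ↥(Dp p) →ₗ[ℂ] ↥(Dp p)) : Prop :=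
  ∀ (k : ℤ) (f : Polynomial ℂ) (A : ↥(Dp p)), (A : Module.End ℂ LaurentV) = op k (f * p) →
    ((σ A : Module.End ℂ LaurentV)) =
      ((-1 : ℂ) ^ p.natDegree * e ^ k) •
        op k ((f.comp (Polynomial.C (c - (k : ℂ)) - Polynomial.X)) * p)

/-- The graded piece (𝒟_p^±)_k = {d ∈ (𝒟_p)_k : σ_±(d) = −d}, as a set. -/
def DpmGradeSet (p : Polynomial ℂ) (c e : ℂ) (k : ℤ) : Set (Module.End ℂ LaurentV) :=
  {A | ∃ f : Polynomial ℂ, A = op k (f * p) ∧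
    ((-1 : ℂ) ^ p.natDegree * e ^ k) •
      op k ((f.comp (Polynomial.C (c - (k : ℂ)) - Polynomial.X)) * p) = -A}

/-- The graded piece (𝒟_p^±)_k, as a ℂ-subspace. -/
def DpmGrade (p : Polynomial ℂ) (c e : ℂ) (k : ℤ) : Submodule ℂ (Module.End ℂ LaurentV) :=
  Submodule.span ℂ (DpmGradeSet p c e k)

/-- V has finite codimension in W. -/
def FinCodimIn {M : Type*} [AddCommGroup M] [Module ℂ M] (V W : Submodule ℂ M) : Prop :=
  FiniteDimensional ℂ (↥W ⧸ Submodule.comap W.subtype V)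

open Polynomial in
lemma op_single (k : ℤ) (f : ℂ[X]) (j : ℤ) (a : ℂ) :
    op k f (Finsupp.single j a) = Finsupp.single (j + k) (f.eval (j : ℂ) * a) := by
  simp [op]

open Polynomial in
lemma op_add (k : ℤ) (f g : ℂ[X]) : op k (f + g) = op k f + op k g := by
  refine Finsupp.lhom_ext fun j a => ?_
  simp [op_single, add_mul, -Finsupp.single_mul]

open Polynomial in
lemma op_smul (k : ℤ) (a : ℂ) (f : ℂ[X]) : op k (a • f) = a • op k f := by
  refine Finsupp.lhom_ext fun j b => ?_
  simp [op_single, mul_assoc, -Finsupp.single_mul]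

open Polynomial in
lemma op_mul_op (k l : ℤ) (f g : ℂ[X]) :
    op k f * op l g = op (k + l) (f.comp (X + C (l : ℂ)) * g) := by
  refine Finsupp.lhom_ext fun j b => ?_
  simp [op_single, mul_assoc, add_comm, add_left_comm, -Finsupp.single_mul]

open Polynomial in
lemma polynomial_eq_of_forall_eval_intCast {f g : ℂ[X]}
    (h : ∀ j : ℤ, f.eval (j : ℂ) = g.eval (j : ℂ)) : f = g :=
  eq_of_infinite_eval_eq f g <| (Set.infinite_range_of_injective (Int.cast_injective (α := ℂ))).mono
    (by rintro _ ⟨j, rfl⟩; exact h j)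

open Polynomial in
lemma op_injective (k : ℤ) : Function.Injective (op k) := by
  intro f g h
  refine polynomial_eq_of_forall_eval_intCast fun j => ?_
  have := congrArg (fun A : Module.End ℂ LaurentV => A (Finsupp.single j 1)) h
  simpa only [op_single, mul_one, (Finsupp.single_injective _).eq_iff] using this

lemma op_mem_Dp (p f : Polynomial ℂ) (k : ℤ) : op k (f * p) ∈ Dp p :=
  Submodule.subset_span ⟨k, f, rfl⟩

lemma mem_Dgrade_iff {p : Polynomial ℂ} {j : ℤ} {A : Module.End ℂ LaurentV} :
    A ∈ Dgrade p j ↔ ∃ f : Polynomial ℂ, A = op j (f * p) := by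
  refine ⟨fun h => ?_, fun h => Submodule.subset_span h⟩
  induction h using Submodule.span_induction with
  | mem A h => exact h
  | zero => exact ⟨0, by simpa using (op_smul j 0 0).symm⟩
  | add A B _ _ hA hB =>
    obtain ⟨f, rfl⟩ := hA
    obtain ⟨g, rfl⟩ := hB
    exact ⟨f + g, by rw [add_mul, op_add]⟩
  | smul a A _ hA =>
    obtain ⟨f, rfl⟩ := hA
    exact ⟨a • f, by rw [smul_mul_assoc, op_smul]⟩

open Polynomial in
/-- On each graded piece, a grading-preserving anti-involution is given by a linear involution of
the space of symbols, and the anti-multiplicativity becomes a twisted product rule. -/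
lemma exists_symbol_maps {p : ℂ[X]} (hp : p ≠ 0) {σ : ↥(Dp p) →ₗ[ℂ] ↥(Dp p)}
    (h1 : IsAntiInvolutionOn p σ) (h2 : PreservesGrading p σ) :
    ∃ T : ℤ → ℂ[X] →ₗ[ℂ] ℂ[X],
      (∀ k f, (σ ⟨op k (f * p), op_mem_Dp p f k⟩ : Module.End ℂ LaurentV) = op k (T k f * p)) ∧
      (∀ k f, T k (T k f) = f) ∧
      ∀ k l f g, T (k + l) ((f * p).comp (X + C (l : ℂ)) * g) =
        (T l g * p).comp (X + C (k : ℂ)) * T k f := by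
  have hex : ∀ (k : ℤ) (f : ℂ[X]), ∃ g : ℂ[X],
      (σ ⟨op k (f * p), op_mem_Dp p f k⟩ : Module.End ℂ LaurentV) = op k (g * p) := fun k f =>
    mem_Dgrade_iff.1 (h2 k _ (mem_Dgrade_iff.2 ⟨f, rfl⟩))
  choose T hT using hex
  have cancel : ∀ {k : ℤ} {f g : ℂ[X]}, op k (f * p) = op k (g * p) → f = g := fun h =>
    mul_right_cancel₀ hp (op_injective _ h)
  refine ⟨fun k => ⟨⟨T k, fun f g => cancel (k := k) ?_⟩, fun a f => cancel (k := k) ?_⟩, hT,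
    fun k f => cancel (k := k) ?_, fun k l f g => cancel (k := k + l) ?_⟩
  · rw [add_mul (T k f), op_add, ← hT, ← hT, ← hT, ← Submodule.coe_add, ← map_add]
    congr 2
    ext1
    simp [add_mul, op_add]
  · rw [RingHom.id_apply, smul_mul_assoc a (T k f), op_smul, ← hT, ← hT, ← Submodule.coe_smul,
      ← map_smul]
    congr 2
    ext1
    simp [op_smul]
  · change op k (T k (T k f) * p) = _
    rw [← hT]
    have : (⟨op k (T k f * p), op_mem_Dp p _ k⟩ : Dp p) = σ ⟨op k (f * p), op_mem_Dp p f k⟩ :=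
      Subtype.ext (hT k f).symm
    rw [this, h1.1]
  · change op (k + l) (T (k + l) _ * p) = op (k + l) ((T l g * p).comp _ * T k f * p)
    rw [← hT, h1.2 ⟨op k (f * p), op_mem_Dp p f k⟩ ⟨op l (g * p), op_mem_Dp p g l⟩, hT, hT,
      op_mul_op, add_comm l k, mul_assoc]
    simp only [op_mul_op, mul_assoc]

open Polynomial in
/-- A linear involution of `ℂ[X]` which is multiplicative up to the factor `p` is, up to a sign,
composition with an involutive substitution. -/
lemma exists_comp_of_mul_rule {p : ℂ[X]} (hp : p ≠ 0) {T : ℂ[X] →ₗ[ℂ] ℂ[X]}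
    (hinv : ∀ f, T (T f) = f) (hmul : ∀ f g, T (f * p * g) = T g * p * T f) :
    ∃ (α : ℂ) (q : ℂ[X]), α * α = 1 ∧ q.comp q = X ∧ (∀ f, T f = C α * f.comp q) ∧
      p.comp q = C α * p := by
  set u := T 1 with hu
  have hpg : ∀ g, T (p * g) = T g * p * u := fun g => by simpa using hmul 1 g
  have huu : ∀ g, u * T (u * g) = T g := fun g => by
    have e1 := hmul u g
    rw [hu, hinv, mul_one, ← hu, mul_assoc, mul_left_comm, hpg] at e1
    exact mul_right_cancel₀ hp (by linear_combination e1)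
  have hunit : IsUnit u := by
    have := huu u
    rw [hu, hinv, ← hu] at this
    exact IsUnit.of_mul_eq_one _ this
  obtain ⟨α, -, hα⟩ := Polynomial.isUnit_iff.1 hunit
  have hC : ∀ (a : ℂ) f, T (C a * f) = C a * T f := fun a f => by
    rw [← smul_eq_C_mul, map_smul, smul_eq_C_mul]
  have hαα : α * α = 1 := by
    have h : T (T 1) = 1 := hinv 1
    rw [← hu, ← hα, ← mul_one (C α), hC, ← hu, ← hα, ← C_mul] at h
    exact C_injective (by simpa using h)
  have hCα : (C α * C α : ℂ[X]) = 1 := by rw [← C_mul, hαα, C_1]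
  have hTT : ∀ f g, C α * T (f * g) = T f * T g := fun f g => by
    have e1 := hmul f g
    rw [mul_right_comm, mul_comm _ p, hpg, ← hα] at e1
    exact mul_right_cancel₀ hp (by linear_combination e1)
  let φ : ℂ[X] →ₐ[ℂ] ℂ[X] := AlgHom.ofLinearMap (α • T)
    (by rw [LinearMap.smul_apply, ← hu, ← hα, smul_eq_C_mul, hCα])
    (fun f g => by
      simp only [LinearMap.smul_apply, smul_eq_C_mul]
      linear_combination hTT f g - hCα * T f * T g)
  have hφ : ∀ f, C α * T f = f.comp (C α * T X) := fun f => by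
    have h1 : φ f = C α * T f := smul_eq_C_mul _
    have h2 : φ X = C α * T X := smul_eq_C_mul _
    have h3 := aeval_algHom_apply φ X f
    rw [aeval_X_left_apply, h1, h2] at h3
    rw [← h3]
    rfl
  refine ⟨α, C α * T X, hαα, ?_, fun f => ?_, ?_⟩
  · rw [← hφ, hC, hinv, ← mul_assoc, hCα, one_mul]
  · rw [← hφ, ← mul_assoc, hCα, one_mul]
  · rw [← hφ]
    have := hpg 1
    rw [mul_one, ← hu, ← hα] at this
    rw [this]
    linear_combination C α * p * hCα

open Polynomial in
lemma exists_linear_of_comp_self_eq_X {q : ℂ[X]} (h : q.comp q = X) :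
    ∃ a b : ℂ, q = C a * X + C b := by
  have hd : q.natDegree * q.natDegree = 1 := by rw [← natDegree_comp, h, natDegree_X]
  exact exists_eq_X_add_C_of_natDegree_le_one (Nat.eq_one_of_mul_eq_one_right hd).le

open Polynomial in
/-- The classification of the symbol maps of a grading-preserving anti-involution. -/
lemma symbol_maps_classification {p : ℂ[X]} (hp : p ≠ 0) {T : ℤ → ℂ[X] →ₗ[ℂ] ℂ[X]}
    (hinv : ∀ k f, T k (T k f) = f)
    (hmul : ∀ k l f g, T (k + l) ((f * p).comp (X + C (l : ℂ)) * g) =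
        (T l g * p).comp (X + C (k : ℂ)) * T k f) :
    ∃ c α e : ℂ, p.comp (C c - X) = C α * p ∧ (e = 1 ∨ e = -1) ∧
      ∀ k f, T k f = C (α * e ^ k) * f.comp (C (c - (k : ℂ)) - X) := by
  obtain ⟨α, q, hαα, hqq, hT0, hpq⟩ := exists_comp_of_mul_rule hp (hinv 0)
    (fun f g => by simpa using hmul 0 0 f g)
  have hCα : (C α * C α : ℂ[X]) = 1 := by rw [← C_mul, hαα, C_1]
  obtain ⟨a, b, rfl⟩ := exists_linear_of_comp_self_eq_X hqq
  have hne : ∀ k, T k 1 ≠ 0 := fun k h => by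
    have := hinv k 1
    rw [h, map_zero] at this
    exact zero_ne_one this
  have hshift : ∀ r : ℂ, p.comp (X + C r) ≠ 0 := fun r h => hp <| by
    have e : (X + C r).comp (X - C r) = X := by simp
    rw [← comp_X (p := p), ← e, ← comp_assoc, h, zero_comp]
  have hR : ∀ k f g, T k (f * p * g) =
      C α * g.comp ((C a * X + C b).comp (X + C (k : ℂ))) * p.comp (X + C (k : ℂ)) * T k f :=
    fun k f g => by
      have h := hmul k 0 f g
      simpa only [Int.cast_zero, C_0, add_zero, comp_X, hT0, mul_comp, C_comp, comp_assoc] using h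
  have hL : ∀ k f g, T k ((f * p).comp (X + C (k : ℂ)) * g) =
      T k g * p * (C α * f.comp (C a * X + C b)) := fun k f g => by
    have h := hmul 0 k f g
    simpa only [Int.cast_zero, C_0, add_zero, zero_add, comp_X, hT0] using h
  have ha : a = -1 := by
    have e1 := hL 1 1 (1 * p * X)
    have e2 := hL 1 (X - C 1) (1 * p * 1)
    rw [show ((X - C 1 : ℂ[X]) * p).comp (X + C ((1 : ℤ) : ℂ)) * (1 * p * 1) =
      (1 * p).comp (X + C ((1 : ℤ) : ℂ)) * (1 * p * X : ℂ[X]) by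
        simp only [mul_comp, sub_comp, X_comp, C_comp, one_comp, Int.cast_one]; ring, e1,
      hR, hR] at e2
    simp only [mul_comp, X_comp, C_comp, one_comp, sub_comp, add_comp, Int.cast_one] at e2
    have hnz : C α * C α * p * p.comp (X + C (1 : ℂ)) * T 1 1 ≠ 0 := by
      rw [hCα, one_mul]
      exact mul_ne_zero (mul_ne_zero hp (hshift 1)) (hne 1)
    have e3 : C a * (X + C 1) + C b = (C a * X + C b) - C 1 :=
      mul_left_cancel₀ hnz (by linear_combination e2)
    have := congrArg (eval 0) e3
    simp only [eval_add, eval_sub, eval_mul, eval_C, eval_X] at this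
    linear_combination this
  subst ha
  have hr : ∀ k : ℤ, (C (-1 : ℂ) * X + C b).comp (X + C (k : ℂ)) = C (b - (k : ℂ)) - X :=
      fun k => by
    simp only [add_comp, mul_comp, C_comp, X_comp, C_sub]
    rw [C_neg, C_1]
    ring
  have hq : C (-1 : ℂ) * X + C b = C b - X := by rw [C_neg, C_1]; ring
  rw [hq] at hpq
  have hpk : ∀ k : ℤ, p.comp (C (b - (k : ℂ)) - X) = C α * p.comp (X + C (k : ℂ)) := fun k => by
    have := congrArg (fun f => f.comp (X + C (k : ℂ))) hpq
    simp only [comp_assoc, mul_comp, C_comp] at this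
    rw [← this, ← hr, hq]
  have hTk : ∀ k f, T k f = T k 1 * f.comp (C (b - (k : ℂ)) - X) := fun k f => by
    have e1 := hR k f 1
    have e2 := hR k 1 f
    rw [show f * p * 1 = 1 * p * f by ring, e2, hr, one_comp] at e1
    have hnz : C α * p.comp (X + C (k : ℂ)) ≠ 0 :=
      mul_ne_zero (left_ne_zero_of_mul_eq_one hCα) (hshift _)
    exact mul_left_cancel₀ hnz (by linear_combination -e1)
  have hconst : ∀ k, ∃ β : ℂ, T k 1 = C β ∧ β * β = 1 := fun k => by
    have h := hinv k 1
    rw [hTk k (T k 1)] at h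
    obtain ⟨β, -, hβ⟩ := Polynomial.isUnit_iff.1 (IsUnit.of_mul_eq_one _ h)
    refine ⟨β, hβ.symm, ?_⟩
    rw [← hβ, C_comp, ← C_mul] at h
    exact C_injective (by simpa using h)
  choose β hβ hββ using hconst
  have hβadd : ∀ k l, α * β (k + l) = β k * β l := fun k l => by
    have h := hmul k l 1 1
    rw [hTk, hβ, hβ, hβ, one_mul, mul_one, mul_comp, C_comp, comp_assoc] at h
    have e : (X + C (l : ℂ)).comp (C (b - ((k + l : ℤ) : ℂ)) - X) = C (b - (k : ℂ)) - X := by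
      simp only [add_comp, X_comp, C_comp, Int.cast_add, C_sub, C_add]
      ring
    rw [e, hpk] at h
    refine C_injective (mul_right_cancel₀ (hshift k) ?_)
    simp only [C_mul]
    linear_combination h
  have h0 : β 0 = α := C_injective (by rw [← hβ, hT0]; simp)
  have hee : (α * β 1) * (α * β 1) = 1 := by linear_combination (β 1 * β 1) * hαα + hββ 1
  have hne0 : α * β 1 ≠ 0 := left_ne_zero_of_mul_eq_one hee
  have hstep : ∀ k, α * β (k + 1) = α * β k * (α * β 1) := fun k => by
    rw [hβadd]
    linear_combination (-β k * β 1) * hαα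
  have hpow : ∀ k : ℤ, α * β k = (α * β 1) ^ k := fun k => by
    induction k using Int.induction_on with
    | zero => rw [h0, hαα, zpow_zero]
    | succ k ih => rw [hstep, ih, zpow_add_one₀ hne0]
    | pred k ih =>
      rw [zpow_sub_one₀ hne0, ← ih, eq_mul_inv_iff_mul_eq₀ hne0, ← hstep, sub_add_cancel]
  refine ⟨b, α, α * β 1, hpq, mul_self_eq_one_iff.1 hee, fun k f => ?_⟩
  rw [hTk, hβ, ← hpow, ← mul_assoc, hαα, one_mul]

open Polynomial in
lemma eq_zero_of_eval_add_eq {p : ℂ[X]} (hdeg : 1 ≤ p.natDegree) {d : ℂ}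
    (h : ∀ x, p.eval (x + d) = p.eval x) : d = 0 := by
  by_contra hd
  have hn : ∀ n : ℕ, p.eval (n * d) = p.eval 0 := fun n => by
    induction n with
    | zero => simp
    | succ n ih => rw [← ih, ← h (n * d)]; push_cast; ring_nf
  have hp : p = C (p.eval 0) := eq_of_infinite_eval_eq _ _ <|
    (Set.infinite_range_of_injective (f := fun n : ℕ => (n : ℂ) * d)
      fun m n hmn => Nat.cast_injective (mul_right_cancel₀ hd hmn)).mono (by
        rintro _ ⟨n, rfl⟩
        simpa using hn n)
  rw [hp, natDegree_C] at hdeg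
  omega

open Polynomial in
lemma eq_neg_one_pow_of_comp_C_sub_X {p : ℂ[X]} (hp : p ≠ 0) {c α : ℂ}
    (h : p.comp (C c - X) = C α * p) : α = (-1) ^ p.natDegree := by
  have hd : (C c - X : ℂ[X]).natDegree = 1 := by
    rw [← neg_sub, natDegree_neg, natDegree_X_sub_C]
  have hl := congrArg leadingCoeff h
  rw [leadingCoeff_comp (by rw [hd]; exact one_ne_zero), leadingCoeff_mul, leadingCoeff_C,
    ← neg_sub X, leadingCoeff_neg, leadingCoeff_X_sub_C] at hl
  exact (mul_left_cancel₀ (leadingCoeff_ne_zero.2 hp) (by rw [hl, mul_comm])).symm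

theorem antiinvolution_classification (p : Polynomial ℂ) (hdeg : 1 ≤ p.natDegree)
    (σ : ↥(Dp p) →ₗ[ℂ] ↥(Dp p)) (h1 : IsAntiInvolutionOn p σ) (h2 : PreservesGrading p σ) :
    (∃! c : ℂ, ∀ x : ℂ, p.eval x = (-1 : ℂ) ^ p.natDegree * p.eval (-x + c)) ∧
    (∀ c : ℂ, (∀ x : ℂ, p.eval x = (-1 : ℂ) ^ p.natDegree * p.eval (-x + c)) →
      SigmaFormula p c 1 σ ∨ SigmaFormula p c (-1) σ) := by
  have hp : p ≠ 0 := by rintro rfl; simp at hdeg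
  obtain ⟨T, hσ, hinv, hmul⟩ := exists_symbol_maps hp h1 h2
  obtain ⟨c, α, e, hc, he, hT⟩ := symbol_maps_classification hp hinv hmul
  obtain rfl := eq_neg_one_pow_of_comp_C_sub_X hp hc
  have hsq : ((-1 : ℂ) ^ p.natDegree) * (-1) ^ p.natDegree = 1 := by
    rw [← mul_pow, neg_one_mul, neg_neg, one_pow]
  have hsymm : ∀ x : ℂ, p.eval x = (-1 : ℂ) ^ p.natDegree * p.eval (-x + c) := fun x => by
    have h := congrArg (Polynomial.eval x) hc
    simp only [Polynomial.eval_comp, Polynomial.eval_sub, Polynomial.eval_mul, Polynomial.eval_C,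
      Polynomial.eval_X] at h
    rw [neg_add_eq_sub, h, ← mul_assoc, hsq, one_mul]
  have huniq : ∀ c' : ℂ, (∀ x : ℂ, p.eval x = (-1 : ℂ) ^ p.natDegree * p.eval (-x + c')) →
      c' = c := fun c' hc' => by
    refine sub_eq_zero.1 (eq_zero_of_eval_add_eq hdeg fun x => ?_)
    have h := (hc' (c - x)).symm.trans (hsymm (c - x))
    have h := mul_left_cancel₀ (left_ne_zero_of_mul_eq_one hsq) h
    convert h using 2 <;> ring
  refine ⟨⟨c, hsymm, huniq⟩, fun c' hc' => ?_⟩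
  obtain rfl := huniq c' hc'
  have hform : SigmaFormula p c' e σ := fun k f A hA => by
    obtain rfl : A = ⟨op k (f * p), op_mem_Dp p f k⟩ := Subtype.ext hA
    rw [hσ, hT, ← Polynomial.smul_eq_C_mul, smul_mul_assoc, op_smul]
  rcases he with rfl | rfl
  · exact Or.inl hform
  · exact Or.inr hform

end
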